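/- arXiv:1909.03145 — 2 statements merged into one kernel-verified Lean document; each statement's English description precedes it below -/
import Mathlib

section
/- Let V be a real Hilbert space, 0 ≤ μ ≤ L, and let f ∈ S^{1,1}_{μ,L} with global minimizer x*. Let γ_0 > 0, and for each k ≥ 0 let α_k ∈ (0,1) satisfy L·α_k² = (1 − α_k)γ_k + μ·α_k, and let (x_k, y_k, v_k, γ_k) satisfy Nesterov's scheme: γ_{k+1} = (1 − α_k)γ_k + μ·α_k (so L·α_k² = γ_{k+1}), (y_k − x_k)/α_k = (γ_k/γ_{k+1})(v_k − y_k), (v_{k+1} − v_k)/α_k = (μ/γ_{k+1})(y_k − v_k) − (1/γ_{k+1})∇f(y_k), and x_{k+1} is any point with f(x_{k+1}) ≤ f(y_k) − (1/(2L))‖∇f(y_k)‖². Then for every k ≥ 0, 𝓛_{k+1} ≤ (1 − α_k)·𝓛_k. -/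
open RealInnerProductSpace

theorem stmt10 {V : Type*} [NormedAddCommGroup V] [InnerProductSpace ℝ V] [CompleteSpace V]
    (μ L : ℝ) (hμ : 0 ≤ μ) (hμL : μ ≤ L) (f : V → ℝ) (f' : V → V)
    (hdiff : ∀ z, HasGradientAt f (f' z) z)
    (hconv : ∀ z w : V, f z - f w - ⟪f' w, z - w⟫ ≥ μ / 2 * ‖z - w‖ ^ 2)
    (hlip : ∀ z w : V, ‖f' z - f' w‖ ≤ L * ‖z - w‖)
    (xstar : V) (hmin : ∀ z, f xstar ≤ f z)
    (γ α : ℕ → ℝ) (hγ0 : 0 < γ 0) (hα : ∀ k, 0 < α k ∧ α k < 1)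
    (hstep : ∀ k, L * (α k) ^ 2 = (1 - α k) * γ k + μ * α k)
    (x y v : ℕ → V)
    (hγrec : ∀ k, γ (k + 1) = (1 - α k) * γ k + μ * α k)
    (hyrec : ∀ k, γ (k + 1) • (y k - x k) = (α k * γ k) • (v k - y k))
    (hvrec : ∀ k, γ (k + 1) • (v (k + 1) - v k) = α k • (μ • (y k - v k) - f' (y k)))
    (hxrec : ∀ k, f (x (k + 1)) ≤ f (y k) - 1 / (2 * L) * ‖f' (y k)‖ ^ 2) :
    ∀ k : ℕ,
      f (x (k + 1)) - f xstar + γ (k + 1) / 2 * ‖v (k + 1) - xstar‖ ^ 2 ≤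
        (1 - α k) * (f (x k) - f xstar + γ k / 2 * ‖v k - xstar‖ ^ 2) := by
  have hγ : ∀ k, 0 < γ k := by
    intro k
    induction k with
    | zero => exact hγ0
    | succ n ih =>
      rw [hγrec n]
      have h1 := mul_pos (sub_pos.2 (hα n).2) ih
      have h2 := mul_nonneg hμ (hα n).1.le
      linarith
  intro k
  obtain ⟨ha0, ha1⟩ := hα k
  have hg := hγ k
  have hG := hγ (k + 1)
  have hGr := hγrec k
  have hs := hstep k
  have hyr := hyrec k
  have hvr := hvrec k
  have hxr := hxrec k
  have c1 := hconv (x k) (y k)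
  have c2 := hconv xstar (y k)
  generalize hGdef : γ (k + 1) = G at *
  generalize γ k = g at *
  generalize α k = a at *
  generalize f' (y k) = d at *
  have hLe : L = G / a ^ 2 := by
    field_simp
    linarith
  obtain ⟨p, hp⟩ : ∃ p, p = v k - y k := ⟨_, rfl⟩
  obtain ⟨s, hsd⟩ : ∃ s, s = xstar - y k := ⟨_, rfl⟩
  have hu : x k - y k = (-(a * g / G)) • p := by
    have : x k - y k = - (G⁻¹ • (G • (y k - x k))) := by
      rw [smul_smul, inv_mul_cancel₀ hG.ne', one_smul]; abel
    rw [this, hyr, ← hp, smul_smul, ← neg_smul]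
    congr 1
    field_simp
  have hq : v (k + 1) - xstar = ((1 - a) * g / G) • p - (a / G) • d - s := by
    have h1 : v (k + 1) - v k = G⁻¹ • (G • (v (k + 1) - v k)) := by
      rw [smul_smul, inv_mul_cancel₀ hG.ne', one_smul]
    have h2 : y k - v k = - p := by rw [hp]; abel
    rw [hvr, h2] at h1
    have h3 : v (k + 1) - xstar = (v (k + 1) - v k) + p - s := by rw [hp, hsd]; abel
    have h4 : (1 - a) * g / G = 1 - a * μ / G := by
      field_simp
      linarith
    rw [h3, h1, h4]
    module
  have hvx : v k - xstar = p - s := by rw [hp, hsd]; abel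
  rw [hu] at c1
  rw [← hsd] at c2
  rw [hq, hvx]
  rw [inner_smul_right] at c1
  have e1 : ‖((1 - a) * g / G) • p - (a / G) • d - s‖ ^ 2
      = ((1 - a) * g / G) ^ 2 * ‖p‖ ^ 2 + (a / G) ^ 2 * ‖d‖ ^ 2 + ‖s‖ ^ 2
        - 2 * ((1 - a) * g / G) * (a / G) * ⟪d, p⟫ - 2 * ((1 - a) * g / G) * ⟪p, s⟫
        + 2 * (a / G) * ⟪d, s⟫ := by
    simp only [← real_inner_self_eq_norm_sq, inner_sub_left, inner_sub_right,
      real_inner_smul_left, real_inner_smul_right]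
    rw [real_inner_comm d p, real_inner_comm s p, real_inner_comm s d]
    ring
  have e2 : ‖p - s‖ ^ 2 = ‖p‖ ^ 2 - 2 * ⟪p, s⟫ + ‖s‖ ^ 2 := norm_sub_sq_real p s
  rw [e1, e2]
  have c1' : f (y k) - a * g / G * ⟪d, p⟫ ≤ f (x k) := by
    have : 0 ≤ μ / 2 * ‖(-(a * g / G)) • p‖ ^ 2 := by positivity
    linarith
  have hL2 : 1 / (2 * L) * ‖d‖ ^ 2 = a ^ 2 / (2 * G) * ‖d‖ ^ 2 := by
    rw [hLe]; field_simp
  rw [hL2] at hxr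
  have m1 := mul_le_mul_of_nonneg_left c1' (sub_pos.2 ha1).le
  have m2 := mul_le_mul_of_nonneg_left c2 ha0.le
  have m3 : 0 ≤ (1 - a) * g * (a * μ) / (2 * G) * ‖p‖ ^ 2 := by
    have := sub_pos.2 ha1
    positivity
  have key : G / 2 * (((1 - a) * g / G) ^ 2 * ‖p‖ ^ 2 + (a / G) ^ 2 * ‖d‖ ^ 2 + ‖s‖ ^ 2
        - 2 * ((1 - a) * g / G) * (a / G) * ⟪d, p⟫ - 2 * ((1 - a) * g / G) * ⟪p, s⟫
        + 2 * (a / G) * ⟪d, s⟫)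
      = (1 - a) * (g / 2 * (‖p‖ ^ 2 - 2 * ⟪p, s⟫ + ‖s‖ ^ 2))
        - (1 - a) * g * (a * μ) / (2 * G) * ‖p‖ ^ 2 + a ^ 2 / (2 * G) * ‖d‖ ^ 2
        + a * μ / 2 * ‖s‖ ^ 2 - (1 - a) * (a * g / G * ⟪d, p⟫) + a * ⟪d, s⟫ := by
    have hm : a * μ = G - (1 - a) * g := by linarith
    rw [hm]
    field_simp
    ring
  rw [key]
  linarith
end

section
/- Let V be a real Hilbert space, 0 ≤ μ ≤ L with L > 0, let f ∈ S^{1,1}_{μ,L}, let g : V → ℝ be convex, F = f + g, and let x* be a global minimizer of F. Under the OAG Method-II iteration (γ_0 > 0; α_k ∈ (0,1) with L·α_k² = (1 − α_k)γ_k + μα_k; γ_{k+1} = (1 − α_k)γ_k + μα_k; y_k = (α_k γ_k v_k + γ_{k+1} x_k)/(γ_k + μα_k); G_k satisfying g(z) ≥ g(y_k − G_k/L) + ⟨G_k − ∇f(y_k), z − (y_k − G_k/L)⟩ for all z ∈ V; x_{k+1} = y_k − (1/L)G_k; v_{k+1} = ((1 − α_k)γ_k v_k + α_k(μ y_k − G_k))/γ_{k+1}),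 the Lyapunov function 𝓛_k = F(x_k) − F(x*) + (γ_k/2)‖v_k − x*‖² satisfies, for all k ≥ 0: 𝓛_k ≤ 𝓛_0 · min{ 4L/(√γ_0·k + 2√L)², (1 − √(min{γ_1, μ}/L))^{k} }; and if γ_0 ≥ L, for all k ≥ 1: 𝓛_k ≤ (F(x_0) − F(x*) + (L/2)‖v_0 − x*‖²) · min{ 4/k², (1 − √(μ/L))^{k−1} }. -/
open RealInnerProductSpace

lemma aux_descent {V : Type*} [NormedAddCommGroup V] [InnerProductSpace ℝ V] [CompleteSpace V]
    (L : ℝ) (f : V → ℝ) (f' : V → V)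
    (hdiff : ∀ z, HasGradientAt f (f' z) z)
    (hlip : ∀ z w : V, ‖f' z - f' w‖ ≤ L * ‖z - w‖) (y d : V) :
    f (y + d) ≤ f y + ⟪f' y, d⟫ + L / 2 * ‖d‖ ^ 2 := by
  have hd : ∀ t : ℝ, HasDerivAt (fun t : ℝ => f (y + t • d) - t * ⟪f' y, d⟫ - L / 2 * ‖d‖ ^ 2 * t ^ 2)
      (⟪f' (y + t • d), d⟫ - ⟪f' y, d⟫ - L * ‖d‖ ^ 2 * t) t := by
    intro t
    have h1 : HasDerivAt (fun t : ℝ => y + t • d) d t := by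
      simpa using ((hasDerivAt_id t).smul_const d).const_add y
    have h2 := (hdiff (y + t • d)).hasFDerivAt.comp_hasDerivAt t h1
    have h3 := (h2.sub ((hasDerivAt_id t).mul_const ⟪f' y, d⟫)).sub
      ((hasDerivAt_pow 2 t).const_mul (L / 2 * ‖d‖ ^ 2))
    refine (h3.congr_deriv ?_)
    simp
    ring
  have hanti := antitoneOn_of_deriv_nonpos (convex_Icc (0:ℝ) 1)
    (f := fun t : ℝ => f (y + t • d) - t * ⟪f' y, d⟫ - L / 2 * ‖d‖ ^ 2 * t ^ 2)
    (fun t _ => (hd t).continuousAt.continuousWithinAt)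
    (fun t _ => (hd t).differentiableAt.differentiableWithinAt)
    (by
      intro t ht
      rw [interior_Icc] at ht
      rw [(hd t).deriv, ← inner_sub_left]
      have h1 := real_inner_le_norm (f' (y + t • d) - f' y) d
      have h2 := hlip (y + t • d) y
      rw [add_sub_cancel_left, norm_smul, Real.norm_of_nonneg ht.1.le] at h2
      nlinarith [mul_le_mul_of_nonneg_right h2 (norm_nonneg d)])
  have := hanti (Set.left_mem_Icc.2 zero_le_one) (Set.right_mem_Icc.2 zero_le_one) zero_le_one
  simp at this
  linarith

lemma aux_comp {V : Type*} [NormedAddCommGroup V] [InnerProductSpace ℝ V] [CompleteSpace V]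
    (μ L : ℝ) (hL : 0 < L) (f : V → ℝ) (f' : V → V)
    (hdiff : ∀ z, HasGradientAt f (f' z) z)
    (hconv : ∀ z w : V, f z - f w - ⟪f' w, z - w⟫ ≥ μ / 2 * ‖z - w‖ ^ 2)
    (hlip : ∀ z w : V, ‖f' z - f' w‖ ≤ L * ‖z - w‖)
    (g : V → ℝ) (y G z : V)
    (hG : g z ≥ g (y - (1 / L) • G) + ⟪G - f' y, z - (y - (1 / L) • G)⟫) :
    f (y - (1 / L) • G) + g (y - (1 / L) • G) + ⟪G, z - y⟫ + 1 / (2 * L) * ‖G‖ ^ 2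
      + μ / 2 * ‖z - y‖ ^ 2 ≤ f z + g z := by
  have h1 := aux_descent L f f' hdiff hlip y (-((1 / L) • G))
  have h2 := hconv z y
  rw [← sub_eq_add_neg, norm_neg, norm_smul, Real.norm_of_nonneg (by positivity), inner_neg_right,
    inner_smul_right] at h1
  have e : z - (y - (1 / L) • G) = (z - y) + (1 / L) • G := by abel
  rw [e, inner_add_right, inner_smul_right, inner_sub_left, inner_sub_left,
    real_inner_self_eq_norm_sq] at hG
  have e1 : L / 2 * (1 / L * ‖G‖) ^ 2 = 1 / (2 * L) * ‖G‖ ^ 2 := by field_simp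
  have e2 : 1 / L * ‖G‖ ^ 2 = 2 * (1 / (2 * L) * ‖G‖ ^ 2) := by field_simp
  rw [mul_sub] at hG
  linarith

lemma aux_step {V : Type*} [NormedAddCommGroup V] [InnerProductSpace ℝ V]
    (μ L γ γ' α : ℝ) (hμ : 0 ≤ μ) (hL : 0 < L) (hγ : 0 < γ) (hα : 0 < α) (hα1 : α < 1)
    (hs : L * α ^ 2 = γ') (hγ' : γ' = (1 - α) * γ + μ * α)
    (x y v v' G s : V) (Fx Fs Fn : ℝ)
    (hy : (γ + μ * α) • y = (α * γ) • v + γ' • x)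
    (hv : γ' • v' = ((1 - α) * γ) • v + α • (μ • y - G))
    (h1 : Fn + ⟪G, x - y⟫ + 1 / (2 * L) * ‖G‖ ^ 2 + μ / 2 * ‖x - y‖ ^ 2 ≤ Fx)
    (h2 : Fn + ⟪G, s - y⟫ + 1 / (2 * L) * ‖G‖ ^ 2 + μ / 2 * ‖s - y‖ ^ 2 ≤ Fs) :
    Fn - Fs + γ' / 2 * ‖v' - s‖ ^ 2 ≤ (1 - α) * (Fx - Fs + γ / 2 * ‖v - s‖ ^ 2) := by
  have hp : 0 < γ' := by rw [← hs]; positivity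
  -- variables p = v - s, q = y - s
  have e0 : γ' • (x - y) = -((α * γ) • (v - y)) := by
    have : γ' • x = (γ + μ * α) • y - (α * γ) • v := by rw [hy]; abel
    rw [smul_sub, this, hγ']; module
  have e1 : γ' • (v' - s) = ((1 - α) * γ) • (v - s) + (α * μ) • (y - s) - α • G := by
    rw [smul_sub, hv, hγ']; module
  have e0' : γ' * ⟪G, x - y⟫ = -(α * γ * (⟪G, v - s⟫ - ⟪G, y - s⟫)) := by
    rw [← inner_smul_right, e0, inner_neg_right, inner_smul_right, ← inner_sub_right,
      sub_sub_sub_cancel_right]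
  have e1' : γ' ^ 2 * ‖v' - s‖ ^ 2 = ((1 - α) * γ) ^ 2 * ‖v - s‖ ^ 2 + (α * μ) ^ 2 * ‖y - s‖ ^ 2
      + α ^ 2 * ‖G‖ ^ 2 + 2 * ((1 - α) * γ) * (α * μ) * ⟪v - s, y - s⟫
      - 2 * ((1 - α) * γ) * α * ⟪G, v - s⟫ - 2 * (α * μ) * α * ⟪G, y - s⟫ := by
    have : γ' ^ 2 * ‖v' - s‖ ^ 2 = ‖γ' • (v' - s)‖ ^ 2 := by
      rw [norm_smul, mul_pow, Real.norm_eq_abs, sq_abs]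
    rw [this, e1, ← real_inner_self_eq_norm_sq, ← real_inner_self_eq_norm_sq,
      ← real_inner_self_eq_norm_sq, ← real_inner_self_eq_norm_sq]
    simp only [inner_sub_left (𝕜 := ℝ) (_ + _), inner_sub_right (𝕜 := ℝ) _ (_ + _), inner_add_left,
      inner_add_right, real_inner_smul_left, real_inner_smul_right]
    rw [real_inner_comm G (v - s), real_inner_comm G (y - s), real_inner_comm (v - s) (y - s)]
    ring
  have e2 : ⟪G, s - y⟫ = - ⟪G, y - s⟫ := by rw [← inner_neg_right]; congr 1; abel
  rw [e2, norm_sub_rev s y] at h2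
  have e3 : 0 ≤ ‖v - s‖ ^ 2 - 2 * ⟪v - s, y - s⟫ + ‖y - s‖ ^ 2 := by
    rw [← norm_sub_sq_real]; positivity
  have e4 : 0 ≤ ‖x - y‖ ^ 2 := by positivity
  generalize ‖x - y‖ ^ 2 = X at *
  generalize ‖v - s‖ ^ 2 = P at *
  generalize ‖v' - s‖ ^ 2 = R at *
  generalize ‖y - s‖ ^ 2 = Q at *
  generalize ‖G‖ ^ 2 = N at *
  generalize ⟪G, x - y⟫ = gx at *
  generalize ⟪G, v - s⟫ = gv at *
  generalize ⟪G, y - s⟫ = gy at *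
  generalize ⟪v - s, y - s⟫ = pq at *
  have hNN : γ' * (1 / (2 * L) * N) = α ^ 2 * N / 2 := by rw [← hs]; field_simp
  generalize 1 / (2 * L) * N = M at *
  refine le_of_mul_le_mul_left ?_ hp
  have k1 := mul_le_mul_of_nonneg_left h1 (mul_nonneg hp.le (sub_nonneg.2 hα1.le))
  have k2 := mul_le_mul_of_nonneg_left h2 (mul_nonneg hp.le hα.le)
  have k3 : 0 ≤ (1 - α) * γ * (α * μ) / 2 * (P - 2 * pq + Q) :=
    mul_nonneg (by have := sub_pos.2 hα1; positivity) e3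
  have k4 : 0 ≤ γ' * (1 - α) * (μ / 2 * X) :=
    by have := sub_pos.2 hα1; positivity
  have m1 : γ' * (1 - α) * gx = (1 - α) * (-(α * γ * (gv - gy))) := by rw [← e0']; ring
  have m2 : γ' * (γ' / 2 * R) = (γ' ^ 2 * R) / 2 := by ring
  rw [mul_add γ' (Fn - Fs), m2, e1']
  have m3 : γ' * (1 - α) * M = (1 - α) * (α ^ 2 * N / 2) := by rw [← hNN]; ring
  have m4 : γ' * α * M = α * (α ^ 2 * N / 2) := by rw [← hNN]; ring
  have m5 : γ' * α * (μ / 2 * Q) = ((1 - α) * γ + μ * α) * α * (μ / 2 * Q) := by rw [hγ']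
  have m6 : γ' * α * gy = ((1 - α) * γ + μ * α) * α * gy := by rw [hγ']
  have m7 : γ' * ((1 - α) * (γ / 2 * P)) = ((1 - α) * γ + μ * α) * ((1 - α) * (γ / 2 * P)) := by
    rw [hγ']
  linarith

lemma aux_rate (a b c l T α : ℝ) (ha : 0 < a) (hb : 0 < b) (hc : 0 ≤ c) (hl : 0 < l)
    (hα : 0 < α) (hab : b ^ 2 = (1 - α) * a ^ 2) (h : c * b ≤ α * l) (hT : a * T ≤ 2 * l) :
    b * (T + c) ≤ 2 * l := by
  have hba : b ≤ a := by
    refine le_of_sq_le_sq ?_ ha.le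
    nlinarith [mul_pos hα (pow_pos ha 2)]
  have h1 : α * a ≤ 2 * (a - b) := by
    refine le_of_mul_le_mul_left ?_ ha
    nlinarith
  have h2 : c * a * b ≤ 2 * l * (a - b) := by nlinarith
  refine le_of_mul_le_mul_left ?_ ha
  nlinarith

theorem stmt16 {V : Type*} [NormedAddCommGroup V] [InnerProductSpace ℝ V] [CompleteSpace V]
    (μ L : ℝ) (hμ : 0 ≤ μ) (hμL : μ ≤ L) (hL : 0 < L) (f : V → ℝ) (f' : V → V)
    (hdiff : ∀ z, HasGradientAt f (f' z) z)
    (hconv : ∀ z w : V, f z - f w - ⟪f' w, z - w⟫ ≥ μ / 2 * ‖z - w‖ ^ 2)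
    (hlip : ∀ z w : V, ‖f' z - f' w‖ ≤ L * ‖z - w‖)
    (g : V → ℝ) (hg : ConvexOn ℝ Set.univ g)
    (xstar : V) (hmin : ∀ z, f xstar + g xstar ≤ f z + g z)
    (γ α : ℕ → ℝ) (hγ0 : 0 < γ 0) (hα : ∀ k, 0 < α k ∧ α k < 1)
    (hstep : ∀ k, L * (α k) ^ 2 = (1 - α k) * γ k + μ * α k)
    (x y v G : ℕ → V)
    (hγrec : ∀ k, γ (k + 1) = (1 - α k) * γ k + μ * α k)
    (hyrec : ∀ k, (γ k + μ * α k) • y k = (α k * γ k) • v k + γ (k + 1) • x k)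
    (hG : ∀ k, ∀ z : V, g z ≥ g (y k - (1 / L) • G k) +
      ⟪G k - f' (y k), z - (y k - (1 / L) • G k)⟫)
    (hxrec : ∀ k, x (k + 1) = y k - (1 / L) • G k)
    (hvrec : ∀ k, γ (k + 1) • v (k + 1) =
      ((1 - α k) * γ k) • v k + α k • (μ • y k - G k)) :
    (∀ k : ℕ,
      (f (x k) + g (x k)) - (f xstar + g xstar) + γ k / 2 * ‖v k - xstar‖ ^ 2 ≤
        ((f (x 0) + g (x 0)) - (f xstar + g xstar) + γ 0 / 2 * ‖v 0 - xstar‖ ^ 2) *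
          min (4 * L / (Real.sqrt (γ 0) * k + 2 * Real.sqrt L) ^ 2)
            ((1 - Real.sqrt (min (γ 1) μ / L)) ^ k)) ∧
    (γ 0 ≥ L → ∀ k : ℕ, 1 ≤ k →
      (f (x k) + g (x k)) - (f xstar + g xstar) + γ k / 2 * ‖v k - xstar‖ ^ 2 ≤
        ((f (x 0) + g (x 0)) - (f xstar + g xstar) + L / 2 * ‖v 0 - xstar‖ ^ 2) *
          min (4 / (k : ℝ) ^ 2) ((1 - Real.sqrt (μ / L)) ^ (k - 1))) := by
  have hγpos : ∀ k, 0 < γ k := by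
    intro k
    induction k with
    | zero => exact hγ0
    | succ k ih =>
      rw [hγrec, ← hstep]
      have := (hα k).1
      positivity
  set E : ℕ → ℝ := fun k =>
    (f (x k) + g (x k)) - (f xstar + g xstar) + γ k / 2 * ‖v k - xstar‖ ^ 2 with hE
  have hstepE : ∀ k, E (k + 1) ≤ (1 - α k) * E k := by
    intro k
    have hc := fun z => aux_comp μ L hL f f' hdiff hconv hlip g (y k) (G k) z (hG k z)
    simp only [← hxrec] at hc
    exact aux_step μ L (γ k) (γ (k + 1)) (α k) hμ hL (hγpos k) (hα k).1 (hα k).2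
      ((hstep k).trans (hγrec k).symm) (hγrec k) (x k) (y k) (v k) (v (k + 1)) (G k) xstar _ _ _
      (hyrec k) (hvrec k) (hc (x k)) (hc xstar)
  have hEnn : ∀ k, 0 ≤ E k := by
    intro k
    have h1 := hmin (x k)
    have h2 := hγpos k
    have h3 : 0 ≤ γ k / 2 * ‖v k - xstar‖ ^ 2 := by positivity
    simp only [hE]
    linarith
  set lam : ℕ → ℝ := fun k => ∏ i ∈ Finset.range k, (1 - α i) with hlam
  have lam0 : lam 0 = 1 := by simp [hlam]
  have lamS : ∀ k, lam (k + 1) = lam k * (1 - α k) := fun k => Finset.prod_range_succ _ _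
  have lampos : ∀ k, 0 < lam k := fun k => Finset.prod_pos fun i _ => sub_pos.2 (hα i).2
  have hElam : ∀ k, E k ≤ lam k * E 0 := by
    intro k
    induction k with
    | zero => simp [lam0]
    | succ k ih =>
      rw [lamS]
      have := mul_le_mul_of_nonneg_left ih (sub_pos.2 (hα k).2).le
      linarith [hstepE k]
  have hγlam : ∀ k, γ 0 * lam k ≤ γ k := by
    intro k
    induction k with
    | zero => simp [lam0]
    | succ k ih =>
      rw [lamS, hγrec]
      have := mul_le_mul_of_nonneg_left ih (sub_pos.2 (hα k).2).le
      have := mul_nonneg hμ (hα k).1.le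
      linarith
  have hαγ : ∀ k, L * α k ^ 2 = γ (k + 1) := fun k => (hstep k).trans (hγrec k).symm
  have hl : 0 < √L := Real.sqrt_pos.2 hL
  have hc : 0 < √(γ 0) := Real.sqrt_pos.2 hγ0
  have hrate : ∀ k : ℕ, √(lam k) * (√(γ 0) * k + 2 * √L) ≤ 2 * √L := by
    intro k
    induction k with
    | zero => simp [lam0]
    | succ k ih =>
      have := aux_rate (√(lam k)) (√(lam (k + 1))) (√(γ 0)) (√L) _ (α k)
        (Real.sqrt_pos.2 (lampos k)) (Real.sqrt_pos.2 (lampos _)) hc.le hl (hα k).1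
        (by rw [Real.sq_sqrt (lampos _).le, Real.sq_sqrt (lampos _).le, lamS]; ring)
        (by
          refine le_of_sq_le_sq ?_ (mul_pos (hα k).1 hl).le
          rw [mul_pow, mul_pow, Real.sq_sqrt (lampos _).le, Real.sq_sqrt hL.le,
            Real.sq_sqrt hγ0.le]
          linarith [hγlam (k + 1), hαγ k]) ih
      push_cast
      convert this using 2
      ring
  have hrate2 : ∀ k : ℕ, lam k ≤ 4 * L / (√(γ 0) * k + 2 * √L) ^ 2 := by
    intro k
    have hT : 0 < √(γ 0) * k + 2 * √L := by positivity
    rw [le_div_iff₀ (by positivity)]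
    have h1 := pow_le_pow_left₀ (by positivity) (hrate k) 2
    rw [mul_pow, mul_pow, Real.sq_sqrt (lampos _).le, Real.sq_sqrt hL.le] at h1
    linarith
  have hsq : ∀ m : ℝ, ∀ k, m ≤ γ (k + 1) → √(m / L) ≤ α k := by
    intro m k hm
    refine Real.sqrt_le_iff.2 ⟨(hα k).1.le, ?_⟩
    rw [div_le_iff₀ hL]
    linarith [hαγ k]
  have hmin1 : ∀ k, min (γ 1) μ ≤ γ (k + 1) := by
    intro k
    induction k with
    | zero => exact min_le_left _ _
    | succ k ih =>
      rw [hγrec (k + 1)]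
      have h1 := mul_le_mul_of_nonneg_left ih (sub_pos.2 (hα (k + 1)).2).le
      have h2 := mul_le_mul_of_nonneg_left (min_le_right (γ 1) μ) (hα (k + 1)).1.le
      linarith
  refine ⟨fun k => ?_, fun hγL k hk => ?_⟩
  · change E k ≤ E 0 * _
    refine (hElam k).trans ?_
    rw [mul_comm]
    refine mul_le_mul_of_nonneg_left (le_min (hrate2 k) ?_) (hEnn 0)
    calc lam k ≤ ∏ i ∈ Finset.range k, (1 - √(min (γ 1) μ / L)) := by
          refine Finset.prod_le_prod (fun i _ => (sub_pos.2 (hα i).2).le) fun i _ => ?_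
          linarith [hsq _ i (hmin1 i)]
      _ = _ := by simp
  · change E k ≤ _
    have hA : 0 ≤ (f (x 0) + g (x 0)) - (f xstar + g xstar) := by linarith [hmin (x 0)]
    have hB : 0 ≤ ‖v 0 - xstar‖ ^ 2 := by positivity
    have hE0 : E 0 = (f (x 0) + g (x 0)) - (f xstar + g xstar)
      + γ 0 / 2 * ‖v 0 - xstar‖ ^ 2 := rfl
    generalize (f (x 0) + g (x 0)) - (f xstar + g xstar) = A at *
    generalize ‖v 0 - xstar‖ ^ 2 = B at *
    rw [mul_min_of_nonneg _ _ (by positivity)]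
    refine le_min ?_ ?_
    · have hk0 : (0 : ℝ) < k := by exact_mod_cast hk
      have h1 : lam k * γ 0 ≤ 4 / (k : ℝ) ^ 2 * L := by
        have : 4 * L / (√(γ 0) * k + 2 * √L) ^ 2 ≤ 4 * L / (√(γ 0) * k) ^ 2 := by
          gcongr
          linarith
        have h2 := (hrate2 k).trans this
        rw [mul_pow, Real.sq_sqrt hγ0.le] at h2
        calc lam k * γ 0 ≤ 4 * L / (γ 0 * k ^ 2) * γ 0 := by gcongr
          _ = _ := by field_simp
      have h2 : lam k ≤ 4 / (k : ℝ) ^ 2 := by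
        have : lam k * L ≤ 4 / (k : ℝ) ^ 2 * L :=
          (mul_le_mul_of_nonneg_left hγL (lampos k).le).trans h1
        exact le_of_mul_le_mul_right this hL
      refine (hElam k).trans ?_
      rw [hE0]
      have := mul_le_mul_of_nonneg_right h1 hB
      have := mul_le_mul_of_nonneg_right h2 hA
      linarith
    · have hE1 : E 1 ≤ A + L / 2 * B := by
        refine (hstepE 0).trans ?_
        rw [hE0]
        have h1 := hα 0
        have h2 : (1 - α 0) * γ 0 ≤ L := by
          have := mul_nonneg hμ h1.1.le
          nlinarith [hstep 0, mul_nonneg hL.le (by nlinarith : 0 ≤ 1 - α 0 ^ 2)]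
        have := mul_le_mul_of_nonneg_right h2 hB
        have := mul_nonneg h1.1.le hA
        linarith
      have hγμ : ∀ k, μ ≤ γ k := by
        intro k
        induction k with
        | zero => linarith
        | succ k ih =>
          rw [hγrec k]
          have h1 := mul_le_mul_of_nonneg_left ih (sub_pos.2 (hα k).2).le
          linarith
      obtain ⟨j, rfl⟩ : ∃ j, k = j + 1 := ⟨k - 1, by omega⟩
      rw [Nat.add_sub_cancel]
      clear hk
      induction j with
      | zero => simpa using hE1
      | succ j ih =>
        have h1 := hsq μ (j + 1) (hγμ _)
        have h2 := (hα (j + 1)).2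
        refine (hstepE (j + 1)).trans ?_
        rw [pow_succ, ← mul_assoc, mul_comm]
        exact mul_le_mul ih (by linarith) (by linarith) ((hEnn _).trans ih)
end
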